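/- arXiv:1102.1464 — 13 statements merged into one kernel-verified Lean document; each statement's English description precedes it below -/
import Mathlib

section
/- Let k ≥ 1 and m ≥ 1. The sequence n ↦ (binomial(n, k) mod m), for n ≥ 0, is periodic, and its minimal period length equals m · ∏_{p prime, p ∣ m} p^⌊log_p k⌋. -/
lemma Nat.ModEq.choose_of_le {N k m j : ℕ} (h : ∀ n, (n + N).choose k ≡ n.choose k [MOD m])
    (hj : j ≤ k) (n : ℕ) : (n + N).choose j ≡ n.choose j [MOD m] := by
  induction k generalizing n with
  | zero => obtain rfl : j = 0 := by omega
            exact h n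
  | succ k ih =>
    rcases hj.eq_or_lt with rfl | hj
    · exact h n
    · refine ih (fun n => ?_) (by omega) n
      have h1 := h (n + 1)
      rw [Nat.add_right_comm, Nat.choose_succ_succ',
        Nat.choose_succ_succ'] at h1
      exact Nat.ModEq.add_right_cancel (h n) h1

/-- `N` is a period of `n ↦ n.choose k` modulo `m` iff `m` divides `N.choose j` for `1 ≤ j ≤ k`. -/
lemma Nat.periodic_choose_mod_iff {N k m : ℕ} :
    Function.Periodic (fun n : ℕ => n.choose k % m) N ↔
      ∀ j, 0 < j → j ≤ k → m ∣ N.choose j := by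
  constructor
  · intro h j hj hjk
    have h1 := Nat.ModEq.choose_of_le (fun n => h n) hjk 0
    rw [Nat.zero_add, Nat.choose_eq_zero_of_lt hj] at h1
    exact (Nat.modEq_zero_iff_dvd).1 h1
  · intro h
    suffices H : ∀ n j, j ≤ k → (n + N).choose j ≡ n.choose j [MOD m] from fun n => H n k le_rfl
    intro n
    induction n with
    | zero =>
      intro j hj
      rcases j.eq_zero_or_pos with rfl | h0
      · simp [Nat.ModEq]
      · rw [Nat.zero_add, Nat.choose_eq_zero_of_lt h0]
        exact (Nat.modEq_zero_iff_dvd).2 (h j h0 hj)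
    | succ n ih =>
      rintro (_ | j) hj
      · simp [Nat.ModEq]
      · rw [Nat.add_right_comm, Nat.choose_succ_succ', Nat.choose_succ_succ']
        exact (ih j (by omega)).add (ih (j + 1) hj)

lemma Nat.Prime.not_dvd_choose_of_dvd_succ_choose {p M k j : ℕ} (hp : p.Prime)
    (h : ∀ j, 0 < j → j ≤ k → p ∣ (M + 1).choose j) (hj : j ≤ k) : ¬ p ∣ M.choose j := by
  induction j with
  | zero => simpa using hp.one_lt.ne'
  | succ j ih =>
    intro h1
    have h2 := h (j + 1) (by omega) hj
    rw [Nat.choose_succ_succ'] at h2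
    exact ih (by omega) ((Nat.dvd_add_left h1).1 h2)

lemma Nat.Prime.pow_add_dvd_of_pow_dvd_choose {p e N k i : ℕ} (hp : p.Prime) (he : 0 < e)
    (hN : 0 < N) (h : ∀ j, 0 < j → j ≤ k → p ^ e ∣ N.choose j) (hi : p ^ i ≤ k) :
    p ^ (e + i) ∣ N := by
  obtain ⟨M, rfl⟩ : ∃ M, N = M + 1 := ⟨N - 1, by omega⟩
  have hpos : 0 < p ^ i := pow_pos hp.pos i
  have h1 : p ^ (e + i) ∣ (M + 1) * M.choose (p ^ i - 1) := by
    rw [Nat.add_one_mul_choose_eq, Nat.sub_add_cancel hpos, pow_add]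
    exact Nat.mul_dvd_mul_right (h _ hpos hi) _
  have h2 : ¬ p ∣ M.choose (p ^ i - 1) :=
    hp.not_dvd_choose_of_dvd_succ_choose
      (fun j h0 hj => (dvd_pow_self p he.ne').trans (h j h0 hj)) (by omega)
  exact (((hp.coprime_iff_not_dvd).2 h2).pow_left _).dvd_of_dvd_mul_right h1

lemma Nat.Prime.pow_dvd_choose_of_pow_add_log_dvd {p e N k j : ℕ} (hp : p.Prime)
    (h : p ^ (e + Nat.log p k) ∣ N) (hj : 0 < j) (hjk : j ≤ k) : p ^ e ∣ N.choose j := by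
  rcases N.eq_zero_or_pos with rfl | hN
  · simp [Nat.choose_eq_zero_of_lt hj]
  obtain ⟨M, rfl⟩ : ∃ M, N = M + 1 := ⟨N - 1, by omega⟩
  obtain ⟨i, rfl⟩ : ∃ i, j = i + 1 := ⟨j - 1, by omega⟩
  obtain ⟨a, t, ht, hjt⟩ := Nat.exists_eq_pow_mul_and_not_dvd hj.ne' p hp.ne_one
  have ha : a ≤ Nat.log p k := Nat.le_log_of_pow_le hp.one_lt
    ((Nat.le_of_dvd hj ⟨t, hjt⟩).trans hjk)
  have h1 : p ^ a * p ^ e ∣ p ^ a * (t * (M + 1).choose (i + 1)) := by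
    rw [← mul_assoc, ← hjt, mul_comm (i + 1), ← Nat.add_one_mul_choose_eq, ← pow_add]
    exact ((pow_dvd_pow p (by omega)).trans h).mul_right _
  exact (((hp.coprime_iff_not_dvd).2 ht).pow_left _).dvd_of_dvd_mul_left
    (Nat.dvd_of_mul_dvd_mul_left (pow_pos hp.pos a) h1)

lemma Nat.mul_prod_primeFactors_pow {m : ℕ} (hm : m ≠ 0) (f : ℕ → ℕ) :
    m * ∏ p ∈ m.primeFactors, p ^ f p =
      ∏ p ∈ m.primeFactors, p ^ (m.factorization p + f p) := by
  simp_rw [pow_add, Finset.prod_mul_distrib]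
  congr 1
  exact (Nat.prod_factorization_pow_eq_self hm).symm

/-- (Lu–Tsai) For `k ≥ 1` and `m ≥ 1`, the sequence `n ↦ (n.choose k) % m` is periodic,
with minimal period length `m * ∏_{p prime, p ∣ m} p ^ ⌊log_p k⌋`. -/
theorem lu_tsai_periodicity (k m : ℕ) (hk : 1 ≤ k) (hm : 1 ≤ m) :
    Function.Periodic (fun n : ℕ => n.choose k % m)
      (m * ∏ p ∈ m.primeFactors, p ^ Nat.log p k) ∧
    ∀ N : ℕ, 0 < N → Function.Periodic (fun n : ℕ => n.choose k % m) N →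
      m * ∏ p ∈ m.primeFactors, p ^ Nat.log p k ≤ N := by
  have hm0 : m ≠ 0 := by omega
  simp_rw [Nat.periodic_choose_mod_iff]
  constructor
  · intro j hj hjk
    rw [Nat.dvd_iff_prime_pow_dvd_dvd]
    intro p e hp hpe
    rcases e.eq_zero_or_pos with rfl | he
    · simp
    refine hp.pow_dvd_choose_of_pow_add_log_dvd ?_ hj hjk
    rw [pow_add]
    exact mul_dvd_mul hpe (Finset.dvd_prod_of_mem (fun p => p ^ Nat.log p k)
      (Nat.mem_primeFactors.2 ⟨hp, (dvd_pow_self p he.ne').trans hpe, hm0⟩))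
  · intro N hN h
    rw [Nat.mul_prod_primeFactors_pow hm0]
    refine Nat.le_of_dvd hN (Finset.prod_dvd_of_isRelPrime ?_ ?_)
    · intro p hp q hq hpq
      exact Nat.coprime_iff_isRelPrime.1 (Nat.coprime_pow_primes _ _
        (Nat.prime_of_mem_primeFactors hp) (Nat.prime_of_mem_primeFactors hq) hpq)
    · intro p hp
      have hpp := Nat.prime_of_mem_primeFactors hp
      exact hpp.pow_add_dvd_of_pow_dvd_choose
        (hpp.factorization_pos_of_dvd hm0 (Nat.dvd_of_mem_primeFactors hp)) hN
        (fun j hj hjk => (Nat.ordProj_dvd m p).trans (h j hj hjk))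
        (Nat.pow_log_le_self p (by omega))
end

section
/- If p is a prime and n ≥ 1 with p dividing n, then binomial(n, p) ≡ n/p (mod n). -/
/-- If `p` is prime, `n ≥ 1` and `p ∣ n`, then `C(n,p) ≡ n/p (mod n)`. -/
theorem choose_prime_modEq_div (p n : ℕ) (hp : p.Prime) (hn : 1 ≤ n) (h : p ∣ n) :
    n.choose p ≡ n / p [MOD n] := by
  obtain ⟨m, rfl⟩ := h
  have hp0 : 0 < p := hp.pos
  obtain ⟨k, rfl⟩ : ∃ k, m = k + 1 := Nat.exists_eq_succ_of_ne_zero (by rintro rfl; simp at hn)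
  obtain ⟨q, rfl⟩ : ∃ q, p = q + 1 := Nat.exists_eq_succ_of_ne_zero hp0.ne'
  have : Fact (q + 1).Prime := ⟨hp⟩
  have choose_pred : ((q + 1) * k + q).choose q ≡ 1 [MOD q + 1] := by
    have lucas := Choose.choose_modEq_choose_mod_mul_choose_div_nat
      (n := (q + 1) * k + q) (k := q) (p := q + 1)
    simpa [Nat.mul_add_mod, Nat.mod_eq_of_lt, Nat.div_eq_of_lt] using lucas
  have choose_eq : ((q + 1) * (k + 1)).choose (q + 1) =
      (k + 1) * ((q + 1) * k + q).choose q := by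
    have absorb := Nat.add_one_mul_choose_eq ((q + 1) * k + q) q
    rw [show (q + 1) * k + q + 1 = (q + 1) * (k + 1) by ring] at absorb
    apply Nat.eq_of_mul_eq_mul_left hp0
    linarith
  rw [choose_eq, Nat.mul_div_cancel_left _ hp0, mul_comm (q + 1)]
  simpa using choose_pred.mul_left' (k + 1)
end

section
/- If p is a prime and n ≥ 1 with p dividing n, and ν = ν_p(n) is the exponent of the highest power of p dividing n, then binomial(n, p) ≡ n/p (mod p^ν). -/
/-- If `p` is prime, then `C(pm + p - 1, p - 1) ≡ 1 (mod p)`. -/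
theorem choose_mul_add_pred_modEq_one {p : ℕ} (hp : p.Prime) (m : ℕ) :
    (p * m + (p - 1)).choose (p - 1) ≡ 1 [MOD p] := by
  have : Fact p.Prime := ⟨hp⟩
  have hlt : p - 1 < p := Nat.sub_one_lt hp.ne_zero
  have h := Choose.choose_modEq_choose_mod_mul_choose_div_nat
    (n := p * m + (p - 1)) (k := p - 1) (p := p)
  simpa [Nat.mul_add_mod, Nat.mod_eq_of_lt hlt, Nat.div_eq_of_lt hlt] using h

/-- If `p` is prime, then `C(pm, p) ≡ m (mod pm)`. -/
theorem choose_mul_prime_modEq {p : ℕ} (hp : p.Prime) (m : ℕ) :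
    (p * m).choose p ≡ m [MOD p * m] := by
  rcases m with _ | m
  · simp [Nat.choose_eq_zero_of_lt hp.pos, Nat.ModEq]
  have hn : p * m + (p - 1) + 1 = p * (m + 1) := by
    rw [add_assoc, Nat.sub_add_cancel hp.one_le, mul_add, mul_one]
  have h := Nat.add_one_mul_choose_eq (p * m + (p - 1)) (p - 1)
  rw [hn, Nat.sub_add_cancel hp.one_le, mul_assoc,
    mul_comm _ p] at h
  rw [← Nat.eq_of_mul_eq_mul_left hp.pos h, mul_comm p]
  simpa using (choose_mul_add_pred_modEq_one hp m).mul_left' (m + 1)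

/-- If `p` is prime, `n ≥ 1`, `p ∣ n` and `ν = ν_p(n)`, then `C(n,p) ≡ n/p (mod p^ν)`. -/
theorem choose_prime_modEq_div_pow (p n : ℕ) (hp : p.Prime) (hn : 1 ≤ n) (h : p ∣ n) :
    n.choose p ≡ n / p [MOD p ^ padicValNat p n] := by
  obtain ⟨m, rfl⟩ := h
  rw [Nat.mul_div_cancel_left m hp.pos]
  exact (choose_mul_prime_modEq hp m).of_dvd pow_padicValNat_dvd
end

section
/- If p is a prime and 0 ≤ m ≤ n, then ν_p(binomial(p·n, p·m)) = ν_p(binomial(n, m)). -/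
theorem padicValNat_choose_add_padicValNat_factorial {p n m : ℕ} [Fact p.Prime] (hmn : m ≤ n) :
    padicValNat p (n.choose m) + padicValNat p m.factorial + padicValNat p (n - m).factorial =
      padicValNat p n.factorial := by
  rw [← Nat.choose_mul_factorial_mul_factorial hmn,
    padicValNat.mul (mul_ne_zero (Nat.choose_ne_zero hmn) m.factorial_ne_zero)
      (n - m).factorial_ne_zero,
    padicValNat.mul (Nat.choose_ne_zero hmn) m.factorial_ne_zero]

/-- If `p` is prime and `0 ≤ m ≤ n`, then `ν_p(C(pn, pm)) = ν_p(C(n, m))`. -/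
theorem padicValNat_choose_mul_self (p n m : ℕ) (hp : p.Prime) (hmn : m ≤ n) :
    padicValNat p ((p * n).choose (p * m)) = padicValNat p (n.choose m) := by
  have : Fact p.Prime := ⟨hp⟩
  have h₁ := padicValNat_choose_add_padicValNat_factorial (p := p) hmn
  have h₂ := padicValNat_choose_add_padicValNat_factorial (p := p) (Nat.mul_le_mul_left p hmn)
  rw [← Nat.mul_sub] at h₂
  simp only [padicValNat_factorial_mul] at h₂
  omega
end

section
/- (Anton's theorem) Let p be a prime and 0 ≤ m ≤ n, with base-p digit expansions n = n_l n_{l−1} ⋯ n_1 n_0 and m = m_l m_{l−1} ⋯ m_1 m_0, and let (n−m)_i denote the i-th base-p digit of n − m. Then binomial(n, m) / (−p)^{ν_p(binomial(n,m))} ≡ ∏_{i=0}^{l} n_i! / (m_i! · (n−m)_i!) (mod p), where the product and the quotients on the right-hand side are computed in the field ℤ/pℤ (each factorial of a base-p digit is invertible mod p). -/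
open Finset Nat

/-- The residue mod `p` of `x / (-p) ^ ν`, where `ν` is the `p`-adic valuation of `x`. -/
def signedUnitPart (p x : ℕ) : ZMod p :=
  (-1) ^ padicValNat p x * ((x / p ^ padicValNat p x : ℕ) : ZMod p)

section signedUnitPart

variable {p : ℕ} [hp : Fact p.Prime]

theorem signedUnitPart_mul {x y : ℕ} (hx : x ≠ 0) (hy : y ≠ 0) :
    signedUnitPart p (x * y) = signedUnitPart p x * signedUnitPart p y := by
  simp only [signedUnitPart]
  rw [padicValNat.mul hx hy, pow_add, pow_add,
    Nat.mul_div_mul_comm pow_padicValNat_dvd pow_padicValNat_dvd]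
  push_cast
  ring

theorem signedUnitPart_of_not_dvd {x : ℕ} (hx : ¬p ∣ x) : signedUnitPart p x = x := by
  simp [signedUnitPart, padicValNat.eq_zero_of_not_dvd hx]

theorem signedUnitPart_one : signedUnitPart p 1 = 1 := by
  simp [signedUnitPart]

theorem signedUnitPart_self : signedUnitPart p p = -1 := by
  simp [signedUnitPart, padicValNat_self, Nat.div_self hp.out.pos]

theorem signedUnitPart_factorial_mul_add (q r : ℕ) (hr : r < p) :
    signedUnitPart p (p * q + r)! = signedUnitPart p (p * q)! * (r ! : ZMod p) := by
  induction r with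
  | zero => simp
  | succ r ih =>
    have hndvd : ¬p ∣ p * q + r + 1 := by
      rw [add_assoc, Nat.dvd_add_right (dvd_mul_right p q)]
      exact Nat.not_dvd_of_pos_of_lt r.succ_pos hr
    rw [← add_assoc, Nat.factorial_succ, Nat.factorial_succ,
      signedUnitPart_mul (succ_ne_zero _) (factorial_ne_zero _),
      signedUnitPart_of_not_dvd hndvd, ih (by omega)]
    push_cast
    rw [CharP.cast_eq_zero (ZMod p) p]
    ring

theorem signedUnitPart_factorial_mul (q : ℕ) :
    signedUnitPart p (p * q)! = signedUnitPart p q ! := by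
  induction q with
  | zero => simp
  | succ q ih =>
    have hpos := hp.out.pos
    have hsucc : p * (q + 1) = p * q + (p - 1) + 1 := by rw [mul_add]; omega
    rw [hsucc, Nat.factorial_succ, ← hsucc,
      signedUnitPart_mul (mul_ne_zero hpos.ne' q.succ_ne_zero) (factorial_ne_zero _),
      signedUnitPart_mul hpos.ne' q.succ_ne_zero, signedUnitPart_self,
      signedUnitPart_factorial_mul_add q (p - 1) (by omega), ih, ZMod.wilsons_lemma,
      Nat.factorial_succ, signedUnitPart_mul q.succ_ne_zero (factorial_ne_zero _)]
    ring

theorem signedUnitPart_factorial {n k : ℕ} (hn : n < p ^ k) :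
    signedUnitPart p n ! = ∏ i ∈ range k, ((n / p ^ i % p)! : ZMod p) := by
  induction k generalizing n with
  | zero =>
    obtain rfl : n = 0 := by simpa using hn
    simp [signedUnitPart_one]
  | succ k ih =>
    have hdiv : n / p < p ^ k := Nat.div_lt_of_lt_mul (by rwa [← pow_succ'])
    conv_lhs => rw [← Nat.div_add_mod n p]
    rw [signedUnitPart_factorial_mul_add _ _ (Nat.mod_lt n hp.out.pos),
      signedUnitPart_factorial_mul, ih hdiv, prod_range_succ']
    simp [pow_succ', Nat.div_div_eq_div_mul]

theorem prod_factorial_digit_ne_zero (n k : ℕ) :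
    ∏ i ∈ range k, ((n / p ^ i % p)! : ZMod p) ≠ 0 := by
  refine prod_ne_zero_iff.mpr fun i _ => ?_
  rw [Ne, ZMod.natCast_eq_zero_iff, hp.out.dvd_factorial, not_le]
  exact Nat.mod_lt _ hp.out.pos

end signedUnitPart

/-- (Anton) Let `p` be prime, `m ≤ n`, and let `l` be large enough that all base-`p`
digits of `n` with index `> l` vanish.  Writing `ν = ν_p(C(n,m))`, the integer
`C(n,m) / (-p)^ν = (-1)^ν · (C(n,m) / p^ν)` is congruent mod `p` to the product over
`0 ≤ i ≤ l` of `n_i! / (m_i! · (n-m)_i!)`, computed in the field `ℤ/pℤ` (here the `i`-th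
base-`p` digit of `x` is `x / p^i % p`). -/
theorem anton (p : ℕ) [hp : Fact p.Prime] (n m l : ℕ) (hmn : m ≤ n) (hl : n < p ^ (l + 1)) :
    (-1 : ZMod p) ^ padicValNat p (n.choose m) *
        ((n.choose m / p ^ padicValNat p (n.choose m) : ℕ) : ZMod p) =
      ∏ i ∈ Finset.range (l + 1),
        ((Nat.factorial (n / p ^ i % p) : ZMod p) /
          ((Nat.factorial (m / p ^ i % p) : ZMod p) *
            (Nat.factorial ((n - m) / p ^ i % p) : ZMod p))) := by
  rw [prod_div_distrib, prod_mul_distrib, eq_div_iff (mul_ne_zero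
    (prod_factorial_digit_ne_zero m _) (prod_factorial_digit_ne_zero (n - m) _)),
    ← signedUnitPart_factorial hl, ← signedUnitPart_factorial (hmn.trans_lt hl),
    ← signedUnitPart_factorial ((Nat.sub_le n m).trans_lt hl),
    ← Nat.choose_mul_factorial_mul_factorial hmn,
    signedUnitPart_mul (mul_ne_zero (Nat.choose_pos hmn).ne' (factorial_ne_zero m))
      (factorial_ne_zero _),
    signedUnitPart_mul (Nat.choose_pos hmn).ne' (factorial_ne_zero m)]
  exact (mul_assoc (signedUnitPart p (n.choose m)) _ _).symm
end

section
/- Let p be a prime and n ≥ 1, and let n_1 denote the second base-p digit of n (the coefficient of p in the base-p representation of n). Then Frac((2/n)·binomial(n, 2p)) equals Frac((n_1 − 1)/p) if p divides n, and equals 0 if p does not divide n. -/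
theorem two_mul_choose_two_mul_div {p n : ℕ} (hp : 0 < p) (hn : 1 ≤ n) :
    (2 * n.choose (2 * p) : ℚ) / n = (n - 1).choose (2 * p - 1) / p := by
  obtain ⟨m, rfl⟩ := Nat.exists_eq_add_of_le' hn
  obtain ⟨q, rfl⟩ := Nat.exists_eq_add_of_le' hp
  have h : ((m + 1 : ℕ) * m.choose (2 * q + 1) : ℚ)
      = (m + 1).choose (2 * (q + 1)) * (2 * (q + 1 : ℕ)) := by
    exact_mod_cast Nat.add_one_mul_choose_eq m (2 * q + 1)
  rw [div_eq_div_iff (by positivity) (by positivity), Nat.add_sub_cancel,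
    show 2 * (q + 1) - 1 = 2 * q + 1 by omega]
  linarith

theorem Int.fract_div_eq_fract_div_of_modEq {p : ℕ} {a b : ℤ} (hp : 0 < p)
    (h : a ≡ b [ZMOD p]) : Int.fract ((a : ℚ) / p) = Int.fract ((b : ℚ) / p) := by
  obtain ⟨c, hc⟩ := h.symm.dvd
  rw [Int.fract_eq_fract]
  have h' : (a - b : ℚ) = p * c := by exact_mod_cast hc
  refine ⟨c, ?_⟩
  rw [← sub_div, h', mul_div_cancel_left₀ _ (by positivity)]

theorem choose_sub_one_two_mul_sub_one_modEq {p : ℕ} (hp : p.Prime) (n : ℕ) :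
    ((n - 1).choose (2 * p - 1) : ℤ) ≡
      (((n - 1) % p).choose (p - 1) * ((n - 1) / p : ℕ) : ℤ) [ZMOD p] := by
  have : Fact p.Prime := ⟨hp⟩
  have h := Choose.choose_modEq_choose_mod_mul_choose_div (p := p) (n := n - 1) (k := 2 * p - 1)
  have hk : 2 * p - 1 = (p - 1) + p * 1 := by have := hp.pos; omega
  have hlt : p - 1 < p := Nat.sub_lt hp.pos one_pos
  have hmod : (2 * p - 1) % p = p - 1 := by
    rw [hk, Nat.add_mul_mod_self_left, Nat.mod_eq_of_lt hlt]
  have hdiv : (2 * p - 1) / p = 1 := by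
    rw [hk, Nat.add_mul_div_left _ _ hp.pos, Nat.div_eq_of_lt hlt]
  rw [hmod, hdiv, Nat.choose_one_right] at h
  exact_mod_cast h

/-- If `p` is prime and `n ≥ 1`, with `n₁ = n / p % p` the second base-`p` digit of `n`,
then `Frac((2/n)·C(n,2p))` equals `Frac((n₁ - 1)/p)` if `p ∣ n`, and `0` otherwise. -/
theorem frac_two_choose_two_mul_prime (p n : ℕ) (hp : p.Prime) (hn : 1 ≤ n) :
    Int.fract ((2 * n.choose (2 * p) : ℚ) / n) =
      if p ∣ n then Int.fract (((n / p % p : ℕ) - 1 : ℚ) / p) else 0 := by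
  have hpos := hp.pos
  have hlucas := choose_sub_one_two_mul_sub_one_modEq hp n
  rw [two_mul_choose_two_mul_div hpos hn]
  split_ifs with hdvd
  · obtain ⟨m, rfl⟩ := hdvd
    obtain ⟨k, rfl⟩ :=
      Nat.exists_eq_add_one_of_ne_zero (right_ne_zero_of_mul (Nat.one_le_iff_ne_zero.mp hn))
    have hlt : p - 1 < p := Nat.sub_lt hpos one_pos
    have hsub : p * (k + 1) - 1 = (p - 1) + p * k := by rw [mul_add]; omega
    have hmod : (p * (k + 1) - 1) % p = p - 1 := by
      rw [hsub, Nat.add_mul_mod_self_left, Nat.mod_eq_of_lt hlt]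
    have hdiv : (p * (k + 1) - 1) / p = k := by
      rw [hsub, Nat.add_mul_div_left _ _ hpos, Nat.div_eq_of_lt hlt, zero_add]
    rw [hmod, hdiv, Nat.choose_self, Nat.cast_one, one_mul] at hlucas
    have hdigit : (k : ℤ) ≡ (((k + 1) % p : ℕ) : ℤ) - 1 [ZMOD p] := by
      have := (Int.mod_modEq ((k : ℤ) + 1) p).symm.sub_right 1
      simpa using this
    rw [Nat.mul_div_cancel_left _ hpos]
    have h := Int.fract_div_eq_fract_div_of_modEq hpos (hlucas.trans hdigit)
    rwa [Int.cast_sub, Int.cast_natCast, Int.cast_natCast, Int.cast_one] at h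
  · have hlt : (n - 1) % p < p - 1 := by
      have h1 := Nat.mod_lt (n - 1) hpos
      by_contra! h2
      refine hdvd ⟨(n - 1) / p + 1, ?_⟩
      have h3 := Nat.mod_add_div (n - 1) p
      rw [mul_add]
      omega
    rw [Nat.choose_eq_zero_of_lt hlt, Nat.cast_zero, zero_mul] at hlucas
    simpa using Int.fract_div_eq_fract_div_of_modEq hpos hlucas
end

section
/- If p is an odd prime and n ≥ 1 with p dividing n, then 2·binomial(n, 2p) ≡ (n/p)·((n/p) − 1) (mod n). -/
/-- If `p` is an odd prime, `n ≥ 1` and `p ∣ n`, then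
`2·C(n,2p) ≡ (n/p)·((n/p) - 1) (mod n)`. -/
theorem two_choose_two_mul_prime_modEq (p n : ℕ) (hp : p.Prime) (hodd : Odd p)
    (hn : 1 ≤ n) (h : p ∣ n) :
    2 * n.choose (2 * p) ≡ (n / p) * (n / p - 1) [MOD n] := by
  obtain ⟨m, rfl⟩ := h
  have : Fact p.Prime := ⟨hp⟩
  have hp0 : 0 < p := hp.pos
  obtain ⟨k, rfl⟩ : ∃ k, m = k + 1 := Nat.exists_eq_succ_of_ne_zero (by rintro rfl; simp at hn)
  rw [Nat.mul_div_cancel_left _ hp0, Nat.add_sub_cancel]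
  have lucas : (p - 1 + p * k).choose (p - 1 + p * 1) ≡ k [MOD p] := by
    have hlt : p - 1 < p := by lia
    have hc := Choose.choose_modEq_choose_mod_mul_choose_div_nat
      (n := p - 1 + p * k) (k := p - 1 + p * 1) (p := p)
    simpa only [Nat.add_mul_mod_self_left, Nat.add_mul_div_left _ _ hp0, Nat.mod_eq_of_lt hlt,
      Nat.div_eq_of_lt hlt, Nat.choose_self, one_mul, zero_add, Nat.choose_one_right] using hc
  have absorb : 2 * (p * (k + 1)).choose (2 * p) =
      (k + 1) * (p - 1 + p * k).choose (p - 1 + p * 1) := by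
    have hs := Nat.add_one_mul_choose_eq (p - 1 + p * k) (p - 1 + p * 1)
    have h₁ : p - 1 + p * k + 1 = p * (k + 1) := by rw [mul_add]; lia
    have h₂ : p - 1 + p * 1 + 1 = 2 * p := by lia
    rw [h₁, h₂] at hs
    refine Nat.eq_of_mul_eq_mul_left hp0 ?_
    linarith
  rw [absorb, mul_comm p]
  exact lucas.mul_left' (k + 1)
end

section
/- For every odd prime p, the sequence n ↦ Frac((1/n)·binomial(n, 2p)), for n ≥ 1, is periodic with period length 2^{⌊log_2(2p−1)⌋ + 1} · p². -/
/-- Modulo a prime `q`, the map `m ↦ C(m,k)` has period `q ^ e` as soon as `k < q ^ e`. -/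
theorem choose_add_prime_pow_modEq {q e k : ℕ} (hq : q.Prime) (hk : k < q ^ e) (m : ℕ) :
    (m + q ^ e).choose k ≡ m.choose k [MOD q] := by
  rw [Nat.add_choose_eq, ← Nat.add_zero (m.choose k), Nat.ModEq.comm,
    ← Finset.add_sum_erase (a := (k, 0)) _ _ (by simp)]
  simp only [Nat.choose_zero_right, mul_one]
  refine Nat.ModEq.add_left _ (Nat.modEq_zero_iff_dvd.2 (Finset.dvd_sum ?_)).symm
  rintro ⟨i, j⟩ hij
  simp only [Finset.mem_erase, Finset.HasAntidiagonal.mem_antidiagonal, ne_eq, Prod.mk.injEq] at hij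
  exact (hq.dvd_choose_pow (by omega) (by omega)).mul_left _

theorem choose_add_mul_prime_pow_modEq {q e k : ℕ} (hq : q.Prime) (hk : k < q ^ e) (m c : ℕ) :
    (m + c * q ^ e).choose k ≡ m.choose k [MOD q] := by
  induction c with
  | zero => simp [Nat.ModEq.refl]
  | succ c ih =>
    rw [Nat.succ_mul, ← Nat.add_assoc]
    exact (choose_add_prime_pow_modEq hq hk _).trans ih

theorem choose_succ_div_succ (m k : ℕ) :
    ((m + 1).choose (k + 1) : ℚ) / (m + 1 : ℕ) = (m.choose k : ℚ) / (k + 1 : ℕ) := by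
  rw [div_eq_div_iff (by positivity) (by positivity)]
  exact_mod_cast (Nat.add_one_mul_choose_eq m k).symm.trans (Nat.mul_comm _ _)

theorem fract_div_eq_of_modEq {a b d : ℕ} (hd : d ≠ 0) (h : a ≡ b [MOD d]) :
    Int.fract ((a : ℚ) / d) = Int.fract ((b : ℚ) / d) := by
  obtain ⟨z, hz⟩ := h.symm.dvd
  refine Int.fract_eq_fract.2 ⟨z, ?_⟩
  have hz' : (a : ℚ) - b = d * z := by exact_mod_cast hz
  rw [← sub_div, hz', mul_div_cancel_left₀ _ (by exact_mod_cast hd)]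

/-- For an odd prime `p`, the sequence `n ↦ Frac((1/n)·C(n,2p))` (for `n ≥ 1`) is
periodic with period length `2^(⌊log₂(2p-1)⌋ + 1) · p²`. -/
theorem frac_choose_two_mul_prime_periodic (p : ℕ) (hp : p.Prime) (hodd : Odd p) :
    ∀ n : ℕ, 1 ≤ n →
      Int.fract (((n + 2 ^ (Nat.log 2 (2 * p - 1) + 1) * p ^ 2).choose (2 * p) : ℚ) /
          (n + 2 ^ (Nat.log 2 (2 * p - 1) + 1) * p ^ 2)) =
        Int.fract ((n.choose (2 * p) : ℚ) / n) := by
  intro n hn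
  obtain ⟨m, rfl⟩ : ∃ m, n = m + 1 := ⟨n - 1, by omega⟩
  obtain ⟨k, hk⟩ : ∃ k, 2 * p = k + 1 := ⟨2 * p - 1, by have := hp.pos; omega⟩
  have hk1 : 2 * p - 1 = k := by omega
  have h2 : k < 2 ^ (Nat.log 2 k + 1) := Nat.lt_pow_succ_log_self one_lt_two k
  have hkp : k < p ^ 2 := by nlinarith [hp.two_le]
  rw [hk1, hk]
  set e := Nat.log 2 k + 1
  have hmod : (m + 2 ^ e * p ^ 2).choose k ≡ m.choose k [MOD k + 1] := by
    rw [← hk]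
    refine (Nat.modEq_and_modEq_iff_modEq_mul (Nat.coprime_two_left.2 hodd)).1 ⟨?_, ?_⟩
    · rw [Nat.mul_comm (2 ^ e)]
      exact choose_add_mul_prime_pow_modEq Nat.prime_two h2 m _
    · exact choose_add_mul_prime_pow_modEq hp hkp m _
  have hfract := fract_div_eq_of_modEq k.succ_ne_zero hmod
  rw [Nat.succ_eq_add_one, ← choose_succ_div_succ, ← choose_succ_div_succ] at hfract
  rw [← hfract, Nat.add_right_comm m 1]
  push_cast
  rw [add_right_comm (m : ℚ) 1]
end

section
/- (Hexel–Sachs, p = 3) For every n ≥ 0, writing a_{3,r}(n) for the number of integers m with 0 ≤ m ≤ n such that binomial(n, m) ≡ r (mod 3), and |n|_d for the number of digits equal to d in the base-3 representation of n, one has 2·a_{3,1}(n) = 2^{|n|_1} · (3^{|n|_2} + 1) and 2·a_{3,2}(n) = 2^{|n|_1} · (3^{|n|_2} − 1). -/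
theorem sum_range_three_mul (f : ℕ → ℕ) (M : ℕ) :
    ∑ m ∈ Finset.range (3 * M), f m =
      ∑ k ∈ Finset.range M, (f (3 * k) + f (3 * k + 1) + f (3 * k + 2)) := by
  induction M with
  | zero => simp
  | succ M ih =>
    rw [Finset.sum_range_succ, ← ih, Nat.mul_succ]
    simp only [Finset.sum_range_succ]
    ring

/-- The number of entries of row `n` of Pascal's triangle congruent to `r` modulo `3`. -/
def rowCount (n r : ℕ) : ℕ :=
  ((Finset.range (n + 1)).filter fun m => n.choose m % 3 = r).card

theorem rowCount_eq_sum {n r M : ℕ} (hr : r ≠ 0) (hM : n < M) :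
    rowCount n r = ∑ m ∈ Finset.range M, if n.choose m % 3 = r then 1 else 0 := by
  rw [rowCount, Finset.card_filter]
  refine Finset.sum_subset (by simpa using hM) fun m _ hm => ?_
  rw [Nat.choose_eq_zero_of_lt (by simpa using hm)]
  simp [hr.symm]

theorem choose_three_mul_add_mod (q k d i : ℕ) (hd : d < 3) (hi : i < 3) :
    (3 * q + d).choose (3 * k + i) % 3 = d.choose i * (q.choose k % 3) % 3 := by
  have h : (3 * q + d).choose (3 * k + i) ≡ _ [MOD 3] :=
    Choose.choose_modEq_choose_mod_mul_choose_div_nat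
  rw [Nat.mul_mod_mod, h, Nat.mul_add_mod, Nat.mul_add_mod, Nat.mod_eq_of_lt hd,
    Nat.mod_eq_of_lt hi, Nat.mul_add_div three_pos, Nat.mul_add_div three_pos,
    Nat.div_eq_of_lt hd, Nat.div_eq_of_lt hi, add_zero, add_zero]

theorem rowCount_three_mul_add (q d r : ℕ) (hd : d < 3) (hr : r ≠ 0) :
    rowCount (3 * q + d) r = ∑ k ∈ Finset.range (q + 1),
      ((if d.choose 0 * (q.choose k % 3) % 3 = r then 1 else 0) +
        (if d.choose 1 * (q.choose k % 3) % 3 = r then 1 else 0) +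
        (if d.choose 2 * (q.choose k % 3) % 3 = r then 1 else 0)) := by
  rw [rowCount_eq_sum hr (show 3 * q + d < 3 * (q + 1) by lia), sum_range_three_mul]
  refine Finset.sum_congr rfl fun k _ => ?_
  rw [← choose_three_mul_add_mod q k d 0 hd (by simp), ← choose_three_mul_add_mod q k d 1 hd (by simp),
    ← choose_three_mul_add_mod q k d 2 hd (by simp), add_zero]

theorem rowCount_three_mul (q r : ℕ) (hr : r ≠ 0) : rowCount (3 * q) r = rowCount q r := by
  have h := rowCount_three_mul_add q 0 r (by simp) hr
  rw [add_zero] at h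
  rw [h, rowCount_eq_sum hr q.lt_succ_self]
  refine Finset.sum_congr rfl fun k _ => ?_
  simp [hr.symm]

theorem rowCount_three_mul_add_one (q r : ℕ) (hr : r ≠ 0) :
    rowCount (3 * q + 1) r = 2 * rowCount q r := by
  rw [rowCount_three_mul_add q 1 r (by simp) hr, rowCount_eq_sum hr q.lt_succ_self,
    Finset.mul_sum]
  refine Finset.sum_congr rfl fun k _ => ?_
  simp [hr.symm, ← two_mul]

theorem rowCount_three_mul_add_two_one (q : ℕ) :
    rowCount (3 * q + 2) 1 = 2 * rowCount q 1 + rowCount q 2 := by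
  rw [rowCount_three_mul_add q 2 1 (by simp) one_ne_zero,
    rowCount_eq_sum one_ne_zero q.lt_succ_self, rowCount_eq_sum two_ne_zero q.lt_succ_self,
    Finset.mul_sum, ← Finset.sum_add_distrib]
  refine Finset.sum_congr rfl fun k _ => ?_
  have : q.choose k % 3 < 3 := Nat.mod_lt _ three_pos
  generalize q.choose k % 3 = x at this ⊢
  interval_cases x <;> rfl

theorem rowCount_three_mul_add_two_two (q : ℕ) :
    rowCount (3 * q + 2) 2 = rowCount q 1 + 2 * rowCount q 2 := by
  rw [rowCount_three_mul_add q 2 2 (by simp) two_ne_zero,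
    rowCount_eq_sum one_ne_zero q.lt_succ_self, rowCount_eq_sum two_ne_zero q.lt_succ_self,
    Finset.mul_sum, ← Finset.sum_add_distrib]
  refine Finset.sum_congr rfl fun k _ => ?_
  have : q.choose k % 3 < 3 := Nat.mod_lt _ three_pos
  generalize q.choose k % 3 = x at this ⊢
  interval_cases x <;> rfl

/-- The Hexel–Sachs formulas in subtraction-free form. -/
theorem two_mul_rowCount (n : ℕ) :
    2 * rowCount n 1 =
        2 ^ (Nat.digits 3 n).count 1 * 3 ^ (Nat.digits 3 n).count 2 +
          2 ^ (Nat.digits 3 n).count 1 ∧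
      2 * rowCount n 2 + 2 ^ (Nat.digits 3 n).count 1 =
        2 ^ (Nat.digits 3 n).count 1 * 3 ^ (Nat.digits 3 n).count 2 := by
  induction n using Nat.strong_induction_on with
  | _ n ih =>
    rcases n.eq_zero_or_pos with rfl | hn
    · decide
    obtain ⟨q, d, hd, rfl⟩ : ∃ q d, d < 3 ∧ n = 3 * q + d :=
      ⟨n / 3, n % 3, Nat.mod_lt _ three_pos, (Nat.div_add_mod n 3).symm⟩
    obtain ⟨h₁, h₂⟩ := ih q (by lia)
    rw [add_comm (3 * q) d, Nat.digits_add 3 (by simp) d q hd (by lia), add_comm d]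
    interval_cases d
    · simpa [rowCount_three_mul] using ⟨h₁, h₂⟩
    · simp only [rowCount_three_mul_add_one _ _ one_ne_zero,
        rowCount_three_mul_add_one _ _ two_ne_zero, List.count_cons, pow_add]
      norm_num
      constructor <;> linarith
    · simp only [rowCount_three_mul_add_two_one, rowCount_three_mul_add_two_two,
        List.count_cons, pow_add]
      norm_num
      constructor <;> linarith


/-- (Hexel–Sachs, `p = 3`) With `a_{3,r}(n)` the number of `0 ≤ m ≤ n` such that
`C(n,m) ≡ r (mod 3)`, and `|n|_d` the number of base-`3` digits of `n` equal to `d`,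
one has `2·a_{3,1}(n) = 2^{|n|₁}·(3^{|n|₂} + 1)` and `2·a_{3,2}(n) = 2^{|n|₁}·(3^{|n|₂} - 1)`. -/
theorem hexel_sachs_three (n : ℕ) :
    2 * ((Finset.range (n + 1)).filter fun m => n.choose m % 3 = 1).card =
        2 ^ (Nat.digits 3 n).count 1 * (3 ^ (Nat.digits 3 n).count 2 + 1) ∧
    2 * ((Finset.range (n + 1)).filter fun m => n.choose m % 3 = 2).card =
        2 ^ (Nat.digits 3 n).count 1 * (3 ^ (Nat.digits 3 n).count 2 - 1) := by
  obtain ⟨h₁, h₂⟩ := two_mul_rowCount n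
  rw [mul_add, Nat.mul_sub, mul_one]
  exact ⟨h₁, Nat.eq_sub_of_add_eq h₂⟩
end

section
/- (Davis–Webb) For every n ≥ 1, writing a_{4,1}(n) for the number of integers m with 0 ≤ m ≤ n such that binomial(n, m) ≡ 1 (mod 4): if the binary representation of n contains no occurrence of the two-digit block 11 (i.e., no two consecutive 1 digits), then a_{4,1}(n) = 2^{|n|_1}; otherwise a_{4,1}(n) = 2^{|n|_1 − 1}. Here |n|_1 is the number of 1 digits in the binary representation of n. -/
namespace DavisWebb

/-- The quadratic character modulo `4` evaluated at a natural number. -/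
def chi (k : ℕ) : ℤ := ZMod.χ₄ (k : ZMod 4)

/-- The sum of `chi` over the `n`-th row of Pascal's triangle. -/
def rowSum (n : ℕ) : ℤ := ∑ m ∈ Finset.range (n + 1), chi (n.choose m)

/-- The sum of `chi ^ 2` over the `n`-th row, i.e. the number of its odd entries. -/
def rowSqSum (n : ℕ) : ℤ := ∑ m ∈ Finset.range (n + 1), chi (n.choose m) ^ 2

lemma chi_eq (k : ℕ) : chi k = if k % 2 = 0 then 0 else if k % 4 = 1 then 1 else -1 :=
  ZMod.χ₄_nat_eq_if_mod_four k

lemma chi_mul (a b : ℕ) : chi (a * b) = chi a * chi b := by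
  rw [chi, Nat.cast_mul, map_mul, chi, chi]

lemma chi_zero : chi 0 = 0 := by
  simp [chi_eq]

lemma chi_of_even {k : ℕ} (h : k % 2 = 0) : chi k = 0 := by
  simp [chi_eq, h]

lemma chi_four_mul_add_one (k : ℕ) : chi (4 * k + 1) = 1 := by
  rw [chi_eq, if_neg (by omega), if_pos (by omega)]

lemma chi_sq_of_odd (k : ℕ) : chi (2 * k + 1) ^ 2 = 1 := by
  rw [chi_eq]
  split_ifs <;> omega

lemma choose_two_mul_odd_mod_two (n m : ℕ) : (2 * n).choose (2 * m + 1) % 2 = 0 := by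
  rcases n with _ | n
  · simp
  have h := Nat.add_one_mul_choose_eq (2 * n + 1) (2 * m)
  have h' : 2 ∣ (2 * (n + 1)).choose (2 * m + 1) * (2 * m + 1) :=
    ⟨(n + 1) * (2 * n + 1).choose (2 * m), by rw [← mul_assoc]; exact h.symm⟩
  have := (Nat.Coprime.dvd_of_dvd_mul_right (by simp) h')
  omega

lemma choose_two_mul_two_mul_mod_four (n m : ℕ) :
    (2 * n).choose (2 * m) % 4 = n.choose m % 4 := by
  induction n generalizing m with
  | zero => cases m <;> simp [Nat.mul_add]
  | succ n ih =>
    cases m with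
    | zero => simp
    | succ m =>
      have h₁ := ih m
      have h₂ := ih (m + 1)
      have h₃ := choose_two_mul_odd_mod_two n m
      simp only [Nat.mul_add, mul_one] at *
      rw [Nat.choose_succ_succ n m, Nat.choose_succ_succ (2 * n + 1) (2 * m + 1),
        Nat.choose_succ_succ (2 * n) (2 * m), Nat.choose_succ_succ (2 * n) (2 * m + 1)]
      simp only [Nat.succ_eq_add_one, add_assoc, Nat.reduceAdd] at *
      omega

lemma chi_choose_even_even (n m : ℕ) : chi ((2 * n).choose (2 * m)) = chi (n.choose m) := by
  have h := choose_two_mul_two_mul_mod_four n m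
  rw [chi_eq, chi_eq, h, show (2 * n).choose (2 * m) % 2 = n.choose m % 2 by omega]

lemma chi_choose_even_odd (n m : ℕ) : chi ((2 * n).choose (2 * m + 1)) = 0 :=
  chi_of_even (choose_two_mul_odd_mod_two n m)

lemma chi_choose_odd_odd (n m : ℕ) :
    chi ((2 * n + 1).choose (2 * m + 1)) * chi (2 * m + 1) =
      chi (2 * n + 1) * chi (n.choose m) := by
  rw [← chi_choose_even_even n m, ← chi_mul, ← chi_mul, Nat.add_one_mul_choose_eq]

lemma chi_choose_odd_even {n m : ℕ} (hm : m ≤ n) :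
    chi ((2 * n + 1).choose (2 * m)) * chi (2 * (n - m) + 1) =
      chi (2 * n + 1) * chi (n.choose m) := by
  rw [← chi_choose_even_even n m, ← chi_mul, ← chi_mul, mul_comm (2 * n + 1),
    Nat.choose_mul_succ_eq, show 2 * n + 1 - 2 * m = 2 * (n - m) + 1 by omega]

lemma sum_range_two_mul (f : ℕ → ℤ) (n : ℕ) :
    ∑ m ∈ Finset.range (2 * n), f m = ∑ m ∈ Finset.range n, (f (2 * m) + f (2 * m + 1)) := by
  induction n with
  | zero => simp
  | succ n ih => rw [Nat.mul_succ, Finset.sum_range_succ, Finset.sum_range_succ, ih,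
      Finset.sum_range_succ, add_assoc]

lemma rowSum_two_mul (n : ℕ) : rowSum (2 * n) = rowSum n := by
  have h := Finset.sum_range_succ (fun m => chi ((2 * n).choose m)) (2 * n + 1)
  rw [Nat.choose_succ_self, chi_zero, add_zero] at h
  rw [rowSum, ← h, show 2 * n + 1 + 1 = 2 * (n + 1) by ring, sum_range_two_mul, rowSum]
  simp [chi_choose_even_even, chi_choose_even_odd]

lemma rowSqSum_two_mul (n : ℕ) : rowSqSum (2 * n) = rowSqSum n := by
  have h := Finset.sum_range_succ (fun m => chi ((2 * n).choose m) ^ 2) (2 * n + 1)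
  rw [Nat.choose_succ_self, chi_zero, zero_pow two_ne_zero, add_zero] at h
  rw [rowSqSum, ← h, show 2 * n + 1 + 1 = 2 * (n + 1) by ring, sum_range_two_mul, rowSqSum]
  simp [chi_choose_even_even, chi_choose_even_odd]

lemma rowSqSum_two_mul_add_one (n : ℕ) : rowSqSum (2 * n + 1) = 2 * rowSqSum n := by
  rw [rowSqSum, show 2 * n + 1 + 1 = 2 * (n + 1) by ring, sum_range_two_mul, rowSqSum,
    Finset.mul_sum]
  refine Finset.sum_congr rfl fun m hm => ?_
  have h₁ := congrArg (· ^ 2) (chi_choose_odd_odd n m)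
  have h₂ := congrArg (· ^ 2) (chi_choose_odd_even (Finset.mem_range_succ_iff.mp hm))
  simp only [mul_pow, chi_sq_of_odd, one_mul, mul_one] at h₁ h₂
  rw [h₁, h₂, two_mul]

lemma rowSum_four_mul_add_one (n : ℕ) : rowSum (4 * n + 1) = 2 * rowSum n := by
  have h : rowSum (4 * n + 1) = ∑ m ∈ Finset.range (2 * n + 1), 2 * chi ((2 * n).choose m) := by
    rw [rowSum, show 4 * n + 1 + 1 = 2 * (2 * n + 1) by ring, sum_range_two_mul]
    refine Finset.sum_congr rfl fun m hm => ?_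
    have h₁ := chi_choose_odd_odd (2 * n) m
    have h₂ := chi_choose_odd_even (Finset.mem_range_succ_iff.mp hm)
    rw [show 2 * (2 * n) = 4 * n by ring, chi_four_mul_add_one, one_mul] at h₁ h₂
    obtain ⟨j, rfl | rfl⟩ : ∃ j, m = 2 * j ∨ m = 2 * j + 1 := ⟨m / 2, by omega⟩
    · rw [show 2 * (2 * j) + 1 = 4 * j + 1 by ring, chi_four_mul_add_one, mul_one] at h₁
      rw [show 2 * (2 * n - 2 * j) + 1 = 4 * (n - j) + 1 by omega, chi_four_mul_add_one,
        mul_one] at h₂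
      rw [show 2 * (2 * j) + 1 = 4 * j + 1 by ring, h₁, h₂, ← two_mul]
    · rw [chi_choose_even_odd] at h₁ h₂ ⊢
      have h₃ := fun k => pow_ne_zero_iff two_ne_zero |>.mp ((chi_sq_of_odd k).trans_ne one_ne_zero)
      rw [(mul_eq_zero.mp h₁).resolve_right (h₃ _), (mul_eq_zero.mp h₂).resolve_right (h₃ _)]
      simp
  rw [h, ← Finset.mul_sum, ← rowSum_two_mul n, rowSum]

lemma rowSum_four_mul_add_three (n : ℕ) : rowSum (4 * n + 3) = 0 := by
  rw [rowSum, show 4 * n + 3 + 1 = 2 * (2 * n + 1 + 1) by ring, sum_range_two_mul]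
  refine Finset.sum_eq_zero fun m hm => ?_
  have hm' := Finset.mem_range_succ_iff.mp hm
  have h₁ := chi_choose_odd_odd (2 * n + 1) m
  have h₂ := chi_choose_odd_even hm'
  have h₃ : chi (2 * (2 * n + 1 - m) + 1) = -chi (2 * m + 1) := by
    rw [chi_eq, chi_eq]
    split_ifs <;> omega
  rw [h₃, ← h₁] at h₂
  have h₄ := chi_sq_of_odd m
  rw [show 4 * n + 3 = 2 * (2 * n + 1) + 1 by ring]
  linear_combination (-chi (2 * m + 1)) * h₂ -
    (chi ((2 * (2 * n + 1) + 1).choose (2 * m)) +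
      chi ((2 * (2 * n + 1) + 1).choose (2 * m + 1))) * h₄

/-- The binary expansion of `n` has no two consecutive digits `1`. -/
def NoAdjacentOnes (n : ℕ) : Prop := ∀ i : ℕ, ¬ (n.testBit i ∧ n.testBit (i + 1))

lemma noAdjacentOnes_two_mul (n : ℕ) : NoAdjacentOnes (2 * n) ↔ NoAdjacentOnes n := by
  refine ⟨fun h i => ?_, fun h i => ?_⟩
  · simpa [Nat.testBit_add_one] using h (i + 1)
  · cases i with
    | zero => simp
    | succ i => simpa [Nat.testBit_add_one] using h i

lemma noAdjacentOnes_four_mul_add_one (n : ℕ) :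
    NoAdjacentOnes (4 * n + 1) ↔ NoAdjacentOnes n := by
  have h₀ : (4 * n + 1) / 2 = 2 * n := by omega
  rw [← noAdjacentOnes_two_mul n]
  refine ⟨fun h i => ?_, fun h i => ?_⟩
  · have := h (i + 1)
    rwa [Nat.testBit_add_one _ i, Nat.testBit_add_one _ (i + 1), h₀] at this
  · cases i with
    | zero => rw [Nat.testBit_add_one, h₀]; simp
    | succ i => rw [Nat.testBit_add_one _ i, Nat.testBit_add_one _ (i + 1), h₀]; exact h i

lemma not_noAdjacentOnes_four_mul_add_three (n : ℕ) : ¬ NoAdjacentOnes (4 * n + 3) := by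
  refine fun h => h 0 ⟨?_, ?_⟩
  · rw [Nat.testBit_zero]
    exact decide_eq_true (by omega)
  · rw [Nat.testBit_add_one, Nat.testBit_zero]
    exact decide_eq_true (by omega)

lemma count_one_digits_two_mul (n : ℕ) :
    (Nat.digits 2 (2 * n)).count 1 = (Nat.digits 2 n).count 1 := by
  rcases Nat.eq_zero_or_pos n with rfl | hn
  · simp
  · rw [Nat.digits_def' one_lt_two (by omega)]
    simp

lemma count_one_digits_two_mul_add_one (n : ℕ) :
    (Nat.digits 2 (2 * n + 1)).count 1 = (Nat.digits 2 n).count 1 + 1 := by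
  rw [Nat.digits_def' one_lt_two (by omega), show (2 * n + 1) % 2 = 1 by omega,
    show (2 * n + 1) / 2 = n by omega, List.count_cons_self]

lemma rowSqSum_eq (n : ℕ) : rowSqSum n = 2 ^ (Nat.digits 2 n).count 1 := by
  induction n using Nat.strong_induction_on with
  | _ n ih =>
    obtain ⟨k, rfl | rfl⟩ : ∃ k, n = 2 * k ∨ n = 2 * k + 1 := ⟨n / 2, by omega⟩
    · rcases Nat.eq_zero_or_pos k with rfl | hk
      · simp [rowSqSum, chi_eq]
      · rw [rowSqSum_two_mul, ih k (by omega), count_one_digits_two_mul]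
    · rw [rowSqSum_two_mul_add_one, ih k (by omega), count_one_digits_two_mul_add_one, pow_succ']

open Classical in
lemma rowSum_eq (n : ℕ) :
    rowSum n = if NoAdjacentOnes n then 2 ^ (Nat.digits 2 n).count 1 else 0 := by
  induction n using Nat.strong_induction_on with
  | _ n ih =>
    obtain ⟨k, rfl | rfl | rfl⟩ : ∃ k, n = 2 * k ∨ n = 4 * k + 1 ∨ n = 4 * k + 3 := by
      rcases Nat.even_or_odd' n with ⟨k, h | h⟩
      · exact ⟨k, .inl h⟩
      · exact ⟨n / 4, by omega⟩
    · rcases Nat.eq_zero_or_pos k with rfl | hk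
      · simp [rowSum, chi_eq, NoAdjacentOnes]
      · rw [rowSum_two_mul, ih k (by omega), noAdjacentOnes_two_mul, count_one_digits_two_mul]
    · rw [rowSum_four_mul_add_one, ih k (by omega), noAdjacentOnes_four_mul_add_one,
        show 4 * k + 1 = 2 * (2 * k) + 1 by ring, count_one_digits_two_mul_add_one,
        count_one_digits_two_mul, pow_succ', mul_ite, mul_zero]
    · rw [rowSum_four_mul_add_three, if_neg (not_noAdjacentOnes_four_mul_add_three k)]

lemma two_mul_card_filter_eq (n : ℕ) :
    2 * (((Finset.range (n + 1)).filter fun m => n.choose m % 4 = 1).card : ℤ) =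
      rowSum n + rowSqSum n := by
  rw [rowSum, rowSqSum, ← Finset.sum_add_distrib, Finset.card_filter, Nat.cast_sum,
    Finset.mul_sum]
  refine Finset.sum_congr rfl fun m _ => ?_
  rw [chi_eq]
  split_ifs <;> omega

end DavisWebb


open Classical in
/-- (Davis–Webb) For `n ≥ 1`, the number of `0 ≤ m ≤ n` with `C(n,m) ≡ 1 (mod 4)` is
`2^{|n|₁}` if the binary representation of `n` has no two consecutive `1` digits, and
`2^{|n|₁ - 1}` otherwise, where `|n|₁` is the number of binary `1` digits of `n`. -/
theorem davis_webb_one (n : ℕ) (hn : 1 ≤ n) :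
    ((Finset.range (n + 1)).filter fun m => n.choose m % 4 = 1).card =
      if ∀ i : ℕ, ¬ (n.testBit i ∧ n.testBit (i + 1)) then
        2 ^ (Nat.digits 2 n).count 1
      else
        2 ^ ((Nat.digits 2 n).count 1 - 1) := by
  have h := DavisWebb.two_mul_card_filter_eq n
  rw [DavisWebb.rowSum_eq, DavisWebb.rowSqSum_eq, DavisWebb.NoAdjacentOnes] at h
  split_ifs at h ⊢ with hP
  · rw [← two_mul] at h
    exact Nat.eq_of_mul_eq_mul_left two_pos (by exact_mod_cast h)
  · rw [zero_add] at h
    rcases hc : (Nat.digits 2 n).count 1 with _ | c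
    · rw [hc, pow_zero] at h
      omega
    · rw [hc, pow_succ'] at h
      exact Nat.eq_of_mul_eq_mul_left two_pos (by exact_mod_cast h)
end

section
/- (Davis–Webb) For every n ≥ 1, the number of integers m with 0 ≤ m ≤ n such that binomial(n, m) ≡ 2 (mod 4) equals 2^{|n|_1 − 1} · |n|_{10}, where |n|_1 is the number of 1 digits in the binary representation of n and |n|_{10} is the number of occurrences of the two-digit block 10 in the binary representation of n. -/
open Finset in
theorem card_filter_range_two_mul (p : ℕ → Prop) [DecidablePred p] (n : ℕ) :
    #{m ∈ range (2 * n) | p m} =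
      #{m ∈ range n | p (2 * m)} + #{m ∈ range n | p (2 * m + 1)} := by
  simp only [card_filter]
  induction n with
  | zero => simp
  | succ n ih =>
    rw [show 2 * (n + 1) = 2 * n + 1 + 1 by ring]
    simp only [sum_range_succ, ih]
    ring

open Nat in
theorem padicValNat_choose_add {n m : ℕ} (h : m ≤ n) :
    padicValNat 2 (n.choose m) + padicValNat 2 m ! + padicValNat 2 (n - m)! =
      padicValNat 2 n ! := by
  rw [← choose_mul_factorial_mul_factorial h,
    padicValNat.mul (mul_ne_zero (choose_pos h).ne' m.factorial_ne_zero)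
      (n - m).factorial_ne_zero,
    padicValNat.mul (choose_pos h).ne' m.factorial_ne_zero]

theorem padicValNat_choose_two_mul_add {n m a b : ℕ} (hba : b ≤ a) (ha : a < 2) :
    padicValNat 2 ((2 * n + a).choose (2 * m + b)) = padicValNat 2 (n.choose m) := by
  rcases lt_or_ge n m with h | h
  · rw [Nat.choose_eq_zero_of_lt h, Nat.choose_eq_zero_of_lt (by omega)]
  · have h₁ := padicValNat_choose_add h
    have h₂ := padicValNat_choose_add (show 2 * m + b ≤ 2 * n + a by omega)
    rw [show 2 * n + a - (2 * m + b) = 2 * (n - m) + (a - b) by omega,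
      padicValNat_factorial_mul_add _ ha, padicValNat_factorial_mul_add _ (hba.trans_lt ha),
      padicValNat_factorial_mul_add _ ((a.sub_le b).trans_lt ha)] at h₂
    simp only [padicValNat_factorial_mul] at h₂
    omega

theorem mod_four_eq_two_iff_padicValNat (c : ℕ) : c % 4 = 2 ↔ padicValNat 2 c = 1 := by
  rcases eq_or_ne c 0 with rfl | hc
  · simp
  · have h₁ := padicValNat_dvd_iff_le (p := 2) hc (n := 1)
    have h₂ := padicValNat_dvd_iff_le (p := 2) hc (n := 2)
    omega

theorem choose_two_mul_add_mod_four {n m a b : ℕ} (hba : b ≤ a) (ha : a < 2) :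
    (2 * n + a).choose (2 * m + b) % 4 = 2 ↔ n.choose m % 4 = 2 := by
  simp only [mod_four_eq_two_iff_padicValNat, padicValNat_choose_two_mul_add hba ha]

theorem choose_two_mul_add_mod_two {n m a b : ℕ} (ha : a < 2) (hb : b < 2) :
    (2 * n + a).choose (2 * m + b) % 2 = a.choose b * n.choose m % 2 := by
  have h := Choose.choose_modEq_choose_mod_mul_choose_div_nat (p := 2) (n := 2 * n + a)
    (k := 2 * m + b)
  rwa [show (2 * n + a) % 2 = a by omega, show (2 * m + b) % 2 = b by omega,
    show (2 * n + a) / 2 = n by omega, show (2 * m + b) / 2 = m by omega] at h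

theorem choose_even_odd_mod_four (k m : ℕ) :
    (2 * (k + 1)).choose (2 * m + 1) % 4 = 2 ↔ (k + 1) % 2 = 1 ∧ k.choose m % 2 = 1 := by
  have h := Nat.add_one_mul_choose_eq (2 * k + 1) (2 * m)
  have hk : (2 * k + 1).choose (2 * m) % 2 = k.choose m % 2 := by
    simpa using choose_two_mul_add_mod_two (n := k) (m := m) (a := 1) (b := 0)
  have he : (2 * (k + 1)).choose (2 * m + 1) % 2 = 0 := by
    simpa using choose_two_mul_add_mod_two (n := k + 1) (m := m) (a := 0) (b := 1)
  obtain ⟨f, hf⟩ := Nat.dvd_of_mod_eq_zero he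
  rw [show 2 * k + 1 + 1 = 2 * (k + 1) by ring, hf] at h
  have h' : (k + 1) * (2 * k + 1).choose (2 * m) = f * (2 * m + 1) := by linarith
  have hodd : (k + 1) % 2 = 1 ∧ k.choose m % 2 = 1 ↔ f % 2 = 1 ∧ (2 * m + 1) % 2 = 1 := by
    rw [← hk]
    simp only [← Nat.odd_iff, ← Nat.odd_mul, h']
  rw [hf, hodd]
  omega

theorem count_one_digits_two_mul (n : ℕ) :
    (Nat.digits 2 (2 * n)).count 1 = (Nat.digits 2 n).count 1 := by
  rcases n.eq_zero_or_pos with rfl | hn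
  · simp
  · rw [Nat.digits_def' one_lt_two (by omega)]
    simp

theorem count_one_digits_two_mul_add_one (n : ℕ) :
    (Nat.digits 2 (2 * n + 1)).count 1 = (Nat.digits 2 n).count 1 + 1 := by
  rw [Nat.digits_def' one_lt_two (by omega), show (2 * n + 1) % 2 = 1 by omega,
    show (2 * n + 1) / 2 = n by omega, List.count_cons_self]

theorem testBit_eq_false_of_le {n i : ℕ} (h : n ≤ i) : n.testBit i = false :=
  Nat.testBit_lt_two_pow (h.trans_lt i.lt_two_pow_self)

open Finset in
theorem card_block_two_mul_add_one (n : ℕ) :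
    #{i ∈ range (2 * n + 1) | (2 * n + 1).testBit (i + 1) ∧ ¬ (2 * n + 1).testBit i} =
      #{i ∈ range n | n.testBit (i + 1) ∧ ¬ n.testBit i} := by
  have h (i : ℕ) : (2 * n + 1).testBit (i + 1) = n.testBit i := by
    rw [Nat.testBit_add_one, show (2 * n + 1) / 2 = n by omega]
  symm
  apply card_bij (fun i _ => i + 1)
  · intro i hi
    simp only [mem_filter, mem_range, h] at hi ⊢
    exact ⟨by omega, hi.2⟩
  · intro i _ j _ hij
    omega
  · intro i hi
    simp only [mem_filter, mem_range] at hi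
    cases i with
    | zero => simp at hi
    | succ i =>
      simp only [h] at hi
      refine ⟨i, ?_, rfl⟩
      rw [mem_filter, mem_range]
      refine ⟨?_, hi.2⟩
      by_contra! hle
      simp [testBit_eq_false_of_le (hle.trans i.le_succ)] at hi

open Finset in
theorem card_block_two_mul (n : ℕ) :
    #{i ∈ range (2 * n) | (2 * n).testBit (i + 1) ∧ ¬ (2 * n).testBit i} =
      #{i ∈ range n | n.testBit (i + 1) ∧ ¬ n.testBit i} + n % 2 := by
  rcases n.eq_zero_or_pos with rfl | hn
  · simp
  have h (i : ℕ) : (2 * n).testBit (i + 1) = n.testBit i := by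
    rw [Nat.testBit_add_one, show 2 * n / 2 = n by omega]
  have hr : #{i ∈ range (2 * n) | (2 * n).testBit (i + 1) ∧ ¬ (2 * n).testBit i} =
      #{i ∈ range (n + 1) | (2 * n).testBit (i + 1) ∧ ¬ (2 * n).testBit i} := by
    congr 1
    ext i
    simp only [mem_filter, mem_range, h]
    refine and_congr_left fun hi => ?_
    have : i < n := by
      by_contra! hle
      simp [testBit_eq_false_of_le hle] at hi
    omega
  rw [hr, card_filter, sum_range_succ', card_filter]
  simp only [h, Nat.testBit_zero]
  rcases Nat.mod_two_eq_zero_or_one n with h2 | h2 <;> simp [h2]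

open Finset in
theorem card_choose_odd (n : ℕ) :
    #{m ∈ range (n + 1) | n.choose m % 2 = 1} = 2 ^ (Nat.digits 2 n).count 1 := by
  induction n using Nat.strong_induction_on with
  | _ n ih =>
    rcases eq_or_ne n 0 with rfl | hn
    · decide
    obtain ⟨k, rfl | rfl⟩ := n.even_or_odd'
    · have hext : #{m ∈ range (2 * k + 1) | (2 * k).choose m % 2 = 1} =
          #{m ∈ range (2 * (k + 1)) | (2 * k).choose m % 2 = 1} := by
        rw [show 2 * (k + 1) = 2 * k + 1 + 1 by ring, range_add_one (n := 2 * k + 1),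
          filter_insert]
        simp
      have h₀ (m : ℕ) : (2 * k).choose (2 * m) % 2 = k.choose m % 2 := by
        simpa using choose_two_mul_add_mod_two (n := k) (m := m) (a := 0) (b := 0)
      have h₁ (m : ℕ) : (2 * k).choose (2 * m + 1) % 2 = 0 := by
        simpa using choose_two_mul_add_mod_two (n := k) (m := m) (a := 0) (b := 1)
      rw [hext, card_filter_range_two_mul]
      simp only [h₀, h₁, ih k (by omega)]
      simp [count_one_digits_two_mul]
    · have h₀ (m : ℕ) : (2 * k + 1).choose (2 * m) % 2 = k.choose m % 2 := by
        simpa using choose_two_mul_add_mod_two (n := k) (m := m) (a := 1) (b := 0)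
      have h₁ (m : ℕ) : (2 * k + 1).choose (2 * m + 1) % 2 = k.choose m % 2 := by
        simpa using choose_two_mul_add_mod_two (n := k) (m := m) (a := 1) (b := 1)
      rw [show 2 * k + 1 + 1 = 2 * (k + 1) by ring, card_filter_range_two_mul]
      simp only [h₀, h₁, ih k (by omega), count_one_digits_two_mul_add_one]
      ring

open Finset in
theorem card_choose_two_mul_add_one (k : ℕ) :
    #{m ∈ range (2 * k + 1 + 1) | (2 * k + 1).choose m % 4 = 2} =
      2 * #{m ∈ range (k + 1) | k.choose m % 4 = 2} := by
  have h₀ (m : ℕ) : (2 * k + 1).choose (2 * m) % 4 = 2 ↔ k.choose m % 4 = 2 :=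
    choose_two_mul_add_mod_four (b := 0) zero_le_one one_lt_two
  have h₁ (m : ℕ) : (2 * k + 1).choose (2 * m + 1) % 4 = 2 ↔ k.choose m % 4 = 2 :=
    choose_two_mul_add_mod_four le_rfl one_lt_two
  rw [show 2 * k + 1 + 1 = 2 * (k + 1) by ring, card_filter_range_two_mul]
  simp only [h₀, h₁]
  ring

open Finset in
theorem card_choose_two_mul (k : ℕ) :
    #{m ∈ range (2 * (k + 1) + 1) | (2 * (k + 1)).choose m % 4 = 2} =
      #{m ∈ range (k + 1 + 1) | (k + 1).choose m % 4 = 2} +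
        (k + 1) % 2 * 2 ^ ((Nat.digits 2 (k + 1)).count 1 - 1) := by
  have hext : #{m ∈ range (2 * (k + 1) + 1) | (2 * (k + 1)).choose m % 4 = 2} =
      #{m ∈ range (2 * (k + 1 + 1)) | (2 * (k + 1)).choose m % 4 = 2} := by
    rw [show 2 * (k + 1 + 1) = 2 * (k + 1) + 1 + 1 by ring, range_add_one (n := 2 * (k + 1) + 1),
      filter_insert]
    simp
  have h₀ (m : ℕ) : (2 * (k + 1)).choose (2 * m) % 4 = 2 ↔ (k + 1).choose m % 4 = 2 :=
    choose_two_mul_add_mod_four (n := k + 1) (m := m) (a := 0) (b := 0) le_rfl two_pos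
  rw [hext, card_filter_range_two_mul]
  simp only [h₀, choose_even_odd_mod_four]
  congr 1
  obtain ⟨j, rfl | rfl⟩ := k.even_or_odd'
  · have hlast : #{m ∈ range (2 * j + 1 + 1) | (2 * j).choose m % 2 = 1} =
        #{m ∈ range (2 * j + 1) | (2 * j).choose m % 2 = 1} := by
      rw [range_add_one (n := 2 * j + 1), filter_insert]
      simp
    have hodd : (2 * j + 1) % 2 = 1 := by omega
    simp only [hodd, true_and, hlast, card_choose_odd, count_one_digits_two_mul,
      count_one_digits_two_mul_add_one, Nat.add_sub_cancel, one_mul]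
  · have heven : (2 * j + 1 + 1) % 2 = 0 := by omega
    simp [heven]

theorem count_one_digits_two_pos {n : ℕ} (hn : 1 ≤ n) : 0 < (Nat.digits 2 n).count 1 := by
  induction n using Nat.strong_induction_on with
  | _ n ih =>
    obtain ⟨k, rfl | rfl⟩ := n.even_or_odd'
    · rw [count_one_digits_two_mul]
      exact ih k (by omega) (by omega)
    · simp

/-- (Davis–Webb) For `n ≥ 1`, the number of `0 ≤ m ≤ n` with `C(n,m) ≡ 2 (mod 4)` equals
`2^{|n|₁ - 1} · |n|₁₀`, where `|n|₁` is the number of binary `1` digits of `n` and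
`|n|₁₀` is the number of indices `i` whose binary digit in position `i+1` is `1` and in
position `i` is `0` (any such `i` satisfies `i < n`, so counting over `range n` counts
all occurrences of the block `10`). -/
theorem davis_webb_two (n : ℕ) (hn : 1 ≤ n) :
    ((Finset.range (n + 1)).filter fun m => n.choose m % 4 = 2).card =
      2 ^ ((Nat.digits 2 n).count 1 - 1) *
        ((Finset.range n).filter fun i => n.testBit (i + 1) ∧ ¬ n.testBit i).card := by
  induction n using Nat.strong_induction_on with
  | _ n ih =>
    obtain ⟨k, rfl | rfl⟩ := n.even_or_odd'
    · obtain ⟨j, rfl⟩ := Nat.exists_eq_add_of_le' (show 1 ≤ k by omega)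
      rw [card_choose_two_mul, ih (j + 1) (by omega) (by omega), count_one_digits_two_mul,
        card_block_two_mul]
      ring
    · rw [card_choose_two_mul_add_one, count_one_digits_two_mul_add_one,
        card_block_two_mul_add_one]
      rcases k.eq_zero_or_pos with rfl | hk
      · simp
      · rw [ih k (by omega) hk, ← mul_assoc, ← pow_succ', Nat.add_sub_cancel,
          Nat.sub_add_cancel (count_one_digits_two_pos hk)]
end

section
/- (Granville) For every n ≥ 0 and every odd integer r, the number a_{8,r}(n) of integers m with 0 ≤ m ≤ n such that binomial(n, m) ≡ r (mod 8) is either 0 or a power of 2. -/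
/-- The product of the odd numbers in `{1, …, n}`. -/
def oddFactorial : ℕ → ℕ
  | 0 => 1
  | n + 1 => oddFactorial n * if n % 2 = 0 then n + 1 else 1

theorem oddFactorial_two_mul_add_one (k : ℕ) :
    oddFactorial (2 * k + 1) = oddFactorial (2 * k) * (2 * k + 1) := by
  rw [oddFactorial, if_pos (by omega)]

theorem oddFactorial_two_mul_add_two (k : ℕ) :
    oddFactorial (2 * k + 2) = oddFactorial (2 * k) * (2 * k + 1) := by
  rw [oddFactorial, if_neg (by omega), mul_one, oddFactorial_two_mul_add_one]

theorem factorial_eq_oddFactorial (n : ℕ) :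
    n.factorial = 2 ^ (n / 2) * (n / 2).factorial * oddFactorial n := by
  induction n with
  | zero => simp [oddFactorial]
  | succ n ih =>
    rcases Nat.even_or_odd' n with ⟨k, rfl | rfl⟩
    · have h1 : (2 * k + 1) / 2 = k := by omega
      have h2 : 2 * k / 2 = k := by omega
      rw [h2] at ih
      rw [Nat.factorial_succ, ih, h1, oddFactorial_two_mul_add_one]
      ring
    · have h1 : (2 * k + 1 + 1) / 2 = k + 1 := by omega
      have h2 : (2 * k + 1) / 2 = k := by omega
      rw [h2] at ih
      rw [Nat.factorial_succ, ih, h1, oddFactorial_two_mul_add_two, oddFactorial_two_mul_add_one,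
        Nat.factorial_succ]
      ring

theorem oddFactorial_add_eight (n : ℕ) :
    (oddFactorial (n + 8) : ZMod 8) = oddFactorial n := by
  have key : ∀ x : ZMod 8, (2 * x + 1) * (2 * x + 3) * (2 * x + 5) * (2 * x + 7) = 1 := by decide
  have even (k : ℕ) : (oddFactorial (2 * k + 8) : ZMod 8) = oddFactorial (2 * k) := by
    rw [show 2 * k + 8 = 2 * (k + 3) + 2 by ring,
      oddFactorial_two_mul_add_two (k + 3), show 2 * (k + 3) = 2 * (k + 2) + 2 by ring,
      oddFactorial_two_mul_add_two (k + 2), show 2 * (k + 2) = 2 * (k + 1) + 2 by ring,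
      oddFactorial_two_mul_add_two (k + 1), show 2 * (k + 1) = 2 * k + 2 by ring,
      oddFactorial_two_mul_add_two k]
    push_cast
    linear_combination (oddFactorial (2 * k) : ZMod 8) * key k
  rcases Nat.even_or_odd' n with ⟨k, rfl | rfl⟩
  · exact even k
  · have h8 : (8 : ZMod 8) = 0 := by decide
    rw [show 2 * k + 1 + 8 = 2 * (k + 4) + 1 by ring, oddFactorial_two_mul_add_one,
      oddFactorial_two_mul_add_one, Nat.cast_mul, show 2 * (k + 4) = 2 * k + 8 by ring, even k]
    push_cast
    linear_combination (oddFactorial (2 * k) : ZMod 8) * h8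

theorem oddFactorial_mod_eight (n : ℕ) :
    (oddFactorial (n % 8) : ZMod 8) = oddFactorial n :=
  Function.Periodic.map_mod_nat (f := fun n => (oddFactorial n : ZMod 8)) oddFactorial_add_eight n

theorem oddFactorial_mul_self (n : ℕ) : (oddFactorial n : ZMod 8) * oddFactorial n = 1 := by
  rw [← oddFactorial_mod_eight]
  have : n % 8 < 8 := Nat.mod_lt _ (by norm_num)
  generalize n % 8 = a at this
  revert a
  decide

theorem add_xor_of_and_eq_left {n x : ℕ} (h : x &&& n = x) : x + (n ^^^ x) = n := by
  induction n using Nat.strong_induction_on generalizing x with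
  | _ n ih =>
    rcases Nat.eq_zero_or_pos n with rfl | hn
    · simp_all
    · have hd : x / 2 &&& n / 2 = x / 2 := by rw [← Nat.and_div_two, h]
      have hi := ih (n / 2) (by omega) hd
      have hm : x % 2 &&& n % 2 = x % 2 := by
        have := Nat.and_mod_two_pow (a := x) (b := n) (n := 1)
        simpa [h] using this.symm
      have hx : (n ^^^ x) / 2 = n / 2 ^^^ x / 2 := Nat.xor_div_two
      have hxm : (n ^^^ x) % 2 = n % 2 ^^^ x % 2 := by
        simpa using Nat.xor_mod_two_pow (a := n) (b := x) (n := 1)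
      rw [← hx] at hi
      generalize n ^^^ x = z at *
      rcases Nat.mod_two_eq_zero_or_one n with h0 | h0 <;>
        rcases Nat.mod_two_eq_zero_or_one x with h1 | h1 <;>
        simp [h0, h1] at hm hxm <;> omega

/-- One step of the mod `8` analogue of Lucas' theorem. -/
theorem choose_eq_choose_div_two {n x : ℕ} (h : x &&& n = x) :
    (n.choose x : ZMod 8) = (n / 2).choose (x / 2) *
      (oddFactorial n * oddFactorial x * oddFactorial (n ^^^ x)) := by
  have e1 := add_xor_of_and_eq_left h
  have e2 : x / 2 + (n ^^^ x) / 2 = n / 2 := by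
    rw [Nat.xor_div_two]
    exact add_xor_of_and_eq_left (by rw [← Nat.and_div_two, h])
  have key : n.choose x * (oddFactorial x * oddFactorial (n ^^^ x)) =
      (n / 2).choose (x / 2) * oddFactorial n := by
    have f1 := Nat.choose_mul_factorial_mul_factorial (show x ≤ n by omega)
    have f2 := Nat.choose_mul_factorial_mul_factorial (show x / 2 ≤ n / 2 by omega)
    rw [show n - x = n ^^^ x by omega, factorial_eq_oddFactorial x, factorial_eq_oddFactorial (n ^^^ x),
      factorial_eq_oddFactorial n] at f1
    rw [show n / 2 - x / 2 = (n ^^^ x) / 2 by omega] at f2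
    rw [← f2, ← e2, pow_add, e2] at f1
    have hpos : 0 < 2 ^ (x / 2) * 2 ^ ((n ^^^ x) / 2) * (x / 2).factorial *
        ((n ^^^ x) / 2).factorial := by positivity
    apply Nat.eq_of_mul_eq_mul_left hpos
    linarith
  have key' : (n.choose x * (oddFactorial x * oddFactorial (n ^^^ x)) : ZMod 8) =
      (n / 2).choose (x / 2) * oddFactorial n := by exact_mod_cast congrArg Nat.cast key
  have s1 := oddFactorial_mul_self x
  have s2 := oddFactorial_mul_self (n ^^^ x)
  linear_combination (oddFactorial x * oddFactorial (n ^^^ x) : ZMod 8) * key' -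
    (n.choose x : ZMod 8) * s1 * (oddFactorial (n ^^^ x)) ^ 2 - (n.choose x : ZMod 8) * s2

theorem oddFactorial_xor {n x y : ℕ} (hx : x &&& n = x) (hy : y &&& n = y) :
    (oddFactorial n * oddFactorial (x ^^^ y) * oddFactorial (n ^^^ (x ^^^ y)) : ZMod 8) =
      oddFactorial n * oddFactorial x * oddFactorial (n ^^^ x) *
        (oddFactorial n * oddFactorial y * oddFactorial (n ^^^ y)) := by
  have hx' : x % 8 &&& n % 8 = x % 8 := by
    simpa [hx] using (Nat.and_mod_two_pow (a := x) (b := n) (n := 3)).symm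
  have hy' : y % 8 &&& n % 8 = y % 8 := by
    simpa [hy] using (Nat.and_mod_two_pow (a := y) (b := n) (n := 3)).symm
  have hxor (a b : ℕ) : (a ^^^ b) % 8 = a % 8 ^^^ b % 8 := by
    simpa using Nat.xor_mod_two_pow (a := a) (b := b) (n := 3)
  have hn8 : n % 8 < 8 := Nat.mod_lt _ (by norm_num)
  have hx8 : x % 8 < 8 := Nat.mod_lt _ (by norm_num)
  have hy8 : y % 8 < 8 := Nat.mod_lt _ (by norm_num)
  rw [← oddFactorial_mod_eight n, ← oddFactorial_mod_eight x, ← oddFactorial_mod_eight y,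
    ← oddFactorial_mod_eight (x ^^^ y), ← oddFactorial_mod_eight (n ^^^ x),
    ← oddFactorial_mod_eight (n ^^^ y), ← oddFactorial_mod_eight (n ^^^ (x ^^^ y))]
  simp only [hxor]
  generalize n % 8 = n at *
  generalize x % 8 = x at *
  generalize y % 8 = y at *
  clear hx hy hxor
  have key : ∀ n < 8, ∀ x < 8, x &&& n = x → ∀ y < 8, y &&& n = y →
      (oddFactorial n * oddFactorial (x ^^^ y) * oddFactorial (n ^^^ (x ^^^ y)) : ZMod 8) =
      oddFactorial n * oddFactorial x * oddFactorial (n ^^^ x) *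
        (oddFactorial n * oddFactorial y * oddFactorial (n ^^^ y)) := by
    decide +kernel
  exact key n hn8 x hx8 hx' y hy8 hy'

/-- Modulo `8`, the odd entries of a row of Pascal's triangle are multiplicative in the binary
digits of the column index. -/
theorem choose_xor {n x y : ℕ} (hx : x &&& n = x) (hy : y &&& n = y) :
    (n.choose (x ^^^ y) : ZMod 8) = n.choose x * n.choose y := by
  induction n using Nat.strong_induction_on generalizing x y with
  | _ n ih =>
    rcases Nat.eq_zero_or_pos n with rfl | hn
    · obtain rfl : x = 0 := by simpa using hx.symm
      obtain rfl : y = 0 := by simpa using hy.symm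
      simp
    · have hxy : (x ^^^ y) &&& n = x ^^^ y := by rw [Nat.and_xor_distrib_right, hx, hy]
      have hi := ih (n / 2) (by omega) (x := x / 2) (y := y / 2)
        (by rw [← Nat.and_div_two, hx]) (by rw [← Nat.and_div_two, hy])
      rw [choose_eq_choose_div_two hxy, choose_eq_choose_div_two hx, choose_eq_choose_div_two hy,
        Nat.xor_div_two, hi, oddFactorial_xor hx hy]
      ring

theorem and_eq_left_of_odd_choose {n x : ℕ} (h : Odd (n.choose x)) : x &&& n = x := by
  induction n using Nat.strong_induction_on generalizing x with
  | _ n ih =>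
    rcases Nat.eq_zero_or_pos n with rfl | hn
    · rcases x with _ | x <;> simp_all
    · have hl := Choose.choose_modEq_choose_mod_mul_choose_div_nat (n := n) (k := x) (p := 2)
      have ho : Odd ((n % 2).choose (x % 2) * (n / 2).choose (x / 2)) := by
        rw [Nat.odd_iff] at h ⊢
        exact (show _ % 2 = _ % 2 from hl).symm.trans h
      obtain ⟨ho1, ho2⟩ := Nat.odd_mul.1 ho
      have hd := ih (n / 2) (by omega) ho2
      have hxd : (x &&& n) / 2 = x / 2 &&& n / 2 := Nat.and_div_two
      have hxm : (x &&& n) % 2 = x % 2 &&& n % 2 := by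
        simpa using Nat.and_mod_two_pow (a := x) (b := n) (n := 1)
      rw [hd] at hxd
      generalize x &&& n = z at *
      rcases Nat.mod_two_eq_zero_or_one n with h0 | h0 <;>
        rcases Nat.mod_two_eq_zero_or_one x with h1 | h1 <;>
        simp [h0, h1] at ho1 hxm <;> omega

theorem card_eq_two_pow_of_xor_mem (K : Finset ℕ) (h0 : 0 ∈ K)
    (hK : ∀ x ∈ K, ∀ y ∈ K, x ^^^ y ∈ K) : ∃ e, K.card = 2 ^ e := by
  let : Mul K := ⟨fun x y => ⟨x.1 ^^^ y.1, hK _ x.2 _ y.2⟩⟩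
  let : One K := ⟨⟨0, h0⟩⟩
  let : Inv K := ⟨id⟩
  let : Group K := Group.ofLeftAxioms
    (fun x y z => Subtype.ext (Nat.xor_assoc x.1 y.1 z.1))
    (fun x => Subtype.ext (Nat.zero_xor x.1))
    (fun x => Subtype.ext (Nat.xor_self x.1))
  have hp : IsPGroup 2 K := fun x => ⟨1, by
    rw [pow_one, pow_two]
    exact Subtype.ext (Nat.xor_self x.1)⟩
  have : Fact (Nat.Prime 2) := ⟨Nat.prime_two⟩
  obtain ⟨e, he⟩ := IsPGroup.iff_card.1 hp
  exact ⟨e, by simpa using he⟩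

theorem odd_of_cast_zmod_eight_eq {c : ℕ} {r : ℤ} (hr : Odd r) (h : (c : ZMod 8) = r) :
    Odd c := by
  have h' : ((c : ℤ) : ZMod 8) = r := by exact_mod_cast h
  rw [ZMod.intCast_eq_intCast_iff_dvd_sub] at h'
  rw [Int.odd_iff] at hr
  rw [Nat.odd_iff]
  push_cast at h'
  omega


/-- (Granville) For every `n ≥ 0` and every odd integer `r`, the number of `0 ≤ m ≤ n`
with `C(n,m) ≡ r (mod 8)` is either `0` or a power of `2`. -/
theorem granville_mod_eight (n : ℕ) (r : ℤ) (hr : Odd r) :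
    ((Finset.range (n + 1)).filter fun m => ((n.choose m : ZMod 8) = (r : ZMod 8))).card = 0 ∨
    ∃ e : ℕ, ((Finset.range (n + 1)).filter
      fun m => ((n.choose m : ZMod 8) = (r : ZMod 8))).card = 2 ^ e := by
  have hmem {s : ℤ} (hs : Odd s) (x : ℕ) :
      x ∈ (Finset.range (n + 1)).filter (fun m => ((n.choose m : ZMod 8) = (s : ZMod 8))) ↔
        x &&& n = x ∧ (n.choose x : ZMod 8) = s := by
    rw [Finset.mem_filter, Finset.mem_range]
    refine and_congr_left fun h => ⟨fun _ => ?_, fun hx => ?_⟩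
    · exact and_eq_left_of_odd_choose (odd_of_cast_zmod_eight_eq hs h)
    · have : x ≤ n := hx ▸ Nat.and_le_right
      omega
  have hxor {x y : ℕ} (hx : x &&& n = x) (hy : y &&& n = y) : (x ^^^ y) &&& n = x ^^^ y := by
    rw [Nat.and_xor_distrib_right, hx, hy]
  have hsq {x : ℕ} (hx : x &&& n = x) : (n.choose x * n.choose x : ZMod 8) = 1 := by
    rw [← choose_xor hx hx]
    simp
  rcases Finset.eq_empty_or_nonempty ((Finset.range (n + 1)).filter
    fun m => ((n.choose m : ZMod 8) = (r : ZMod 8))) with h | ⟨a, ha⟩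
  · exact Or.inl (by rw [h, Finset.card_empty])
  · right
    obtain ⟨ha, har⟩ := (hmem hr a).1 ha
    obtain ⟨e, he⟩ := card_eq_two_pow_of_xor_mem
      ((Finset.range (n + 1)).filter fun m => ((n.choose m : ZMod 8) = ((1 : ℤ) : ZMod 8)))
      ((hmem odd_one 0).2 (by simp)) (by
        intro x hx y hy
        rw [hmem odd_one] at hx hy ⊢
        exact ⟨hxor hx.1 hy.1, by rw [choose_xor hx.1 hy.1, hx.2, hy.2]; simp⟩)
    refine ⟨e, he ▸ Finset.card_nbij' (· ^^^ a) (· ^^^ a) ?_ ?_ ?_ ?_⟩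
    · intro x hx
      rw [Finset.mem_coe, hmem hr] at hx
      rw [Finset.mem_coe, hmem odd_one]
      exact ⟨hxor hx.1 ha, by
        rw [choose_xor hx.1 ha, hx.2, ← har, hsq ha, Int.cast_one]⟩
    · intro x hx
      rw [Finset.mem_coe, hmem odd_one] at hx
      rw [Finset.mem_coe, hmem hr]
      exact ⟨hxor hx.1 ha, by rw [choose_xor hx.1 ha, hx.2, har, Int.cast_one, one_mul]⟩
    · exact fun x _ => by simp
    · exact fun x _ => by simp
end

section
/- For every n ≥ 1 and every odd integer r, the number a_{16,r}(n) of integers m with 0 ≤ m ≤ n such that binomial(n, m) ≡ r (mod 16) is even. -/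
/-- For every `n ≥ 1` and every odd integer `r`, the number of `0 ≤ m ≤ n` with
`C(n,m) ≡ r (mod 16)` is even. -/
theorem a_sixteen_even (n : ℕ) (hn : 1 ≤ n) (r : ℤ) (hr : Odd r) :
    Even ((Finset.range (n + 1)).filter
      fun m => ((n.choose m : ZMod 16) = (r : ZMod 16))).card := by
  rw [← ZMod.natCast_eq_zero_iff_even, Finset.cast_card]
  refine Finset.sum_involution (fun m _ => n - m) (fun _ _ => by decide) ?_ ?_ ?_
  · intro m hm _ hfix
    simp only [Finset.mem_filter, Finset.mem_range] at hm
    obtain ⟨hmn, hmr⟩ := hm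
    obtain rfl : n = 2 * m := by omega
    have heven : 2 ∣ (2 * m).choose m :=
      Nat.two_dvd_centralBinom_of_one_le (by omega)
    have hdvd : (16 : ℤ) ∣ r - ((2 * m).choose m : ℤ) := by
      refine (ZMod.intCast_eq_intCast_iff_dvd_sub _ _ 16).mp ?_
      exact_mod_cast hmr
    obtain ⟨k, hk⟩ := hr
    omega
  · intro m hm
    simp only [Finset.mem_filter, Finset.mem_range] at hm ⊢
    exact ⟨by omega, by rw [Nat.choose_symm (by omega)]; exact hm.2⟩
  · intro m hm
    simp only [Finset.mem_filter, Finset.mem_range] at hm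
    omega
end
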